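/- Let n, B, m be natural numbers and let S = {z : ℕ | there exists a list L of natural numbers with z ∈ L, every element s of L satisfying 2 ≤ s and s ≤ B, and L.sum = n}. Then m ∈ S and m is an upper bound of S (i.e., every z ∈ S satisfies z ≤ m) if and only if either (B = 2 and m = 2 and 2 ≤ n and n is even) or (2 < B and 2 ≤ m and m ≤ B and (m + 2 ≤ n or n = m) and (m + 1 ≤ B implies (n ≤ m + 2 and n ≠ m + 1)) and (m + 2 ≤ B implies n ≠ m + 2)). (This is the content of the paper's Lemma 2: the effective upper bound EUB — the greatest chunk size appearing in any unfolding scheme for (n, B) — is definable by a quantifier-free Presburger formula ξ_eub, which holds of m exactly when m is this greatest value.) -/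

import Mathlib

/-- The set of chunk sizes appearing in some unfolding scheme for `(n, B)`. -/
def chunkSizes (n B : ℕ) : Set ℕ :=
  {z : ℕ | ∃ L : List ℕ, z ∈ L ∧ (∀ s ∈ L, 2 ≤ s ∧ s ≤ B) ∧ L.sum = n}

theorem exists_list_two_three_sum_eq {k : ℕ} (hk : k ≠ 1) :
    ∃ L : List ℕ, (∀ s ∈ L, s = 2 ∨ s = 3) ∧ L.sum = k := by
  rcases Nat.even_or_odd' k with ⟨a, rfl | rfl⟩
  · refine ⟨List.replicate a 2, fun s hs => Or.inl (List.eq_of_mem_replicate hs), ?_⟩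
    simp [mul_comm]
  · refine ⟨3 :: List.replicate (a - 1) 2, fun s hs => ?_, ?_⟩
    · rcases List.mem_cons.1 hs with rfl | hs
      · exact Or.inr rfl
      · exact Or.inl (List.eq_of_mem_replicate hs)
    · simp only [List.sum_cons, List.sum_replicate, smul_eq_mul]
      omega

theorem sum_ne_one_of_two_le {L : List ℕ} (hL : ∀ s ∈ L, 2 ≤ s) : L.sum ≠ 1 := by
  cases L with
  | nil => simp
  | cons a t =>
    have ha := hL a List.mem_cons_self
    rw [List.sum_cons]
    omega

theorem mem_chunkSizes_iff_of_two_lt {n B z : ℕ} (hB : 2 < B) :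
    z ∈ chunkSizes n B ↔ 2 ≤ z ∧ z ≤ B ∧ (z + 2 ≤ n ∨ n = z) := by
  constructor
  · rintro ⟨L, hz, hL, rfl⟩
    have hsum := List.sum_erase hz
    have hne : (L.erase z).sum ≠ 1 :=
      sum_ne_one_of_two_le fun s hs => (hL s (List.mem_of_mem_erase hs)).1
    have hzB := hL z hz
    omega
  · rintro ⟨h2, hzB, hn⟩
    obtain ⟨L, hL, hsum⟩ := exists_list_two_three_sum_eq (k := n - z) (by omega)
    refine ⟨z :: L, List.mem_cons_self, fun s hs => ?_, ?_⟩
    · rcases List.mem_cons.1 hs with rfl | hs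
      · exact ⟨h2, hzB⟩
      · have := hL s hs
        omega
    · rw [List.sum_cons]
      omega

theorem mem_chunkSizes_two_iff {n z : ℕ} :
    z ∈ chunkSizes n 2 ↔ z = 2 ∧ 2 ≤ n ∧ Even n := by
  constructor
  · rintro ⟨L, hz, hL, rfl⟩
    have h2 : ∀ s ∈ L, s = 2 := fun s hs => le_antisymm (hL s hs).2 (hL s hs).1
    refine ⟨h2 z hz, (hL z hz).1.trans (List.le_sum_of_mem hz), ?_⟩
    rw [List.eq_replicate_of_mem h2]
    simp
  · rintro ⟨rfl, hn, a, rfl⟩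
    refine ⟨List.replicate a 2, List.mem_replicate.2 ⟨by omega, rfl⟩, fun s hs => ?_, ?_⟩
    · rw [List.eq_of_mem_replicate hs]
      exact ⟨le_rfl, le_rfl⟩
    · simp [mul_two]

theorem effective_upper_bound_characterization (n B m : ℕ) :
    (m ∈ chunkSizes n B ∧ ∀ z ∈ chunkSizes n B, z ≤ m) ↔
      ((B = 2 ∧ m = 2 ∧ 2 ≤ n ∧ Even n) ∨
       (2 < B ∧ 2 ≤ m ∧ m ≤ B ∧ (m + 2 ≤ n ∨ n = m) ∧
        (m + 1 ≤ B → (n ≤ m + 2 ∧ n ≠ m + 1)) ∧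
        (m + 2 ≤ B → n ≠ m + 2))) := by
  rcases lt_trichotomy B 2 with hB | rfl | hB
  · constructor
    · rintro ⟨⟨L, hm, hL, -⟩, -⟩
      have := hL m hm
      omega
    · omega
  · simp only [mem_chunkSizes_two_iff]
    constructor
    · rintro ⟨h, -⟩
      exact Or.inl ⟨trivial, h⟩
    · rintro (⟨-, h⟩ | ⟨h, -⟩)
      · exact ⟨h, fun z hz => (hz.1.trans h.1.symm).le⟩
      · exact absurd h (lt_irrefl 2)
  · simp only [mem_chunkSizes_iff_of_two_lt hB]
    constructor
    · rintro ⟨hm, hmax⟩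
      have h1 := hmax (m + 1)
      have h2 := hmax (m + 2)
      right
      omega
    · rintro (⟨h, -⟩ | h)
      · omega
      · refine ⟨by omega, fun z hz => ?_⟩
        omega
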